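/- Let a, b ∈ ℝ with a ≠ 0 and b > 0, and let 𝔤 = 𝒜₄,₆^{a,b} be the 4-dimensional real Lie algebra with brackets [e₁,e₄] = a e₁, [e₂,e₄] = b e₂ − e₃, [e₃,e₄] = e₂ + b e₃. Then for every inner product g on 𝔤 and every alternating 2-form F on 𝔤 such that (g,F) is a solution of the Einstein–Maxwell equations, the metric g is Einstein. (In fact, the only alternating 2-form F on 𝔤 that is both closed and co-closed with respect to any inner product g is F = 0.) -/

import Mathlib

open scoped BigOperators

noncomputable section

/-- The underlying vector space `ℝ⁴` of the 4-dimensional Lie algebra. -/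
abbrev V4 : Type := Fin 4 → ℝ

/-- The standard basis `e₁, e₂, e₃, e₄` (0-indexed). -/
def ee (i : Fin 4) : V4 := Pi.single i 1

/-- `g` is an inner product: a positive-definite symmetric bilinear form. -/
structure IsInnerProduct (g : V4 → V4 → ℝ) : Prop where
  symm : ∀ x y, g x y = g y x
  add_left : ∀ x y z, g (x + y) z = g x z + g y z
  smul_left : ∀ (a : ℝ) (x y : V4), g (a • x) y = a * g x y
  pos : ∀ x : V4, x ≠ 0 → 0 < g x x

/-- `F` is an alternating bilinear 2-form. -/
structure IsAltForm (F : V4 → V4 → ℝ) : Prop where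
  skew : ∀ x y, F x y = - F y x
  add_left : ∀ x y z, F (x + y) z = F x z + F y z
  smul_left : ∀ (a : ℝ) (x y : V4), F (a • x) y = a * F x y

/-- Chevalley–Eilenberg differential of a 2-form with respect to the bracket `br`:
`dF(x,y,z) = −F([x,y],z) + F([x,z],y) − F([y,z],x)`. -/
def cdiff (br : V4 → V4 → V4) (F : V4 → V4 → ℝ) (x y z : V4) : ℝ :=
  - F (br x y) z + F (br x z) y - F (br y z) x

/-- A 2-form is closed if its Chevalley–Eilenberg differential vanishes. -/
def IsClosedForm (br : V4 → V4 → V4) (F : V4 → V4 → ℝ) : Prop :=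
  ∀ x y z, cdiff br F x y z = 0

/-- The Gram matrix of a bilinear form in the standard basis. -/
def gram (g : V4 → V4 → ℝ) : Matrix (Fin 4) (Fin 4) ℝ :=
  Matrix.of fun i j => g (ee i) (ee j)

/-- The inverse Gram matrix. -/
def ginv (g : V4 → V4 → ℝ) : Matrix (Fin 4) (Fin 4) ℝ := (gram g)⁻¹

/-- The inner product induced by `g` on 2-forms:
`⟨α,β⟩ = (1/2) Σ g^{ik} g^{jl} α_{ij} β_{kl}`. -/
def formInner (g : V4 → V4 → ℝ) (α β : V4 → V4 → ℝ) : ℝ :=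
  (1 / 2) * ∑ i, ∑ j, ∑ k, ∑ l,
    ginv g i k * ginv g j l * α (ee i) (ee j) * β (ee k) (ee l)

/-- The volume form of `g` for the orientation `e¹∧e²∧e³∧e⁴`. -/
def vol (g : V4 → V4 → ℝ) (x y z w : V4) : ℝ :=
  Real.sqrt (gram g).det * Matrix.det (Matrix.of fun i j => ![x, y, z, w] i j)

/-- The wedge product of two 2-forms, as a 4-form. -/
def wedge22 (α β : V4 → V4 → ℝ) (x y z w : V4) : ℝ :=
  α x y * β z w - α x z * β y w + α x w * β y z
    + α z w * β x y - α y w * β x z + α y z * β x w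

/-- `sF` is the Hodge star `⋆F` of `F` with respect to `g` and the orientation
`e¹∧e²∧e³∧e⁴`: it is the 2-form with `α ∧ sF = ⟨α,F⟩_g vol_g` for all 2-forms `α`. -/
def IsHodgeStar (g : V4 → V4 → ℝ) (F sF : V4 → V4 → ℝ) : Prop :=
  IsAltForm sF ∧
    ∀ α : V4 → V4 → ℝ, IsAltForm α → ∀ x y z w,
      wedge22 α sF x y z w = formInner g α F * vol g x y z w

/-- `F` is co-closed: `d(⋆F) = 0`. -/
def IsCoclosed (br : V4 → V4 → V4) (g F : V4 → V4 → ℝ) : Prop :=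
  ∃ sF, IsHodgeStar g F sF ∧ IsClosedForm br sF

/-- Koszul expression: `g(∇ₓy, z) = (1/2)(g([x,y],z) − g([y,z],x) + g([z,x],y))`. -/
def koszul (br : V4 → V4 → V4) (g : V4 → V4 → ℝ) (x y z : V4) : ℝ :=
  (1 / 2) * (g (br x y) z - g (br y z) x + g (br z x) y)

/-- The Levi-Civita product `∇ₓ y`, i.e. the unique vector with
`g(∇ₓy, z) = koszul x y z` for all `z` (computed via the inverse Gram matrix). -/
def LC (br : V4 → V4 → V4) (g : V4 → V4 → ℝ) (x y : V4) : V4 :=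
  fun m => ∑ k, koszul br g x y (ee k) * ginv g k m

/-- Curvature `R(x,y)z = ∇ₓ∇_y z − ∇_y∇ₓ z − ∇_{[x,y]} z`. -/
def curv (br : V4 → V4 → V4) (g : V4 → V4 → ℝ) (x y z : V4) : V4 :=
  LC br g x (LC br g y z) - LC br g y (LC br g x z) - LC br g (br x y) z

/-- Ricci tensor `Ric(x,y) = Σᵢ g(R(vᵢ,x)y, vᵢ)` for a `g`-orthonormal basis `(vᵢ)`,
i.e. the trace of the endomorphism `z ↦ R(z,x)y`. -/
def ricci (br : V4 → V4 → V4) (g : V4 → V4 → ℝ) (x y : V4) : ℝ :=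
  ∑ i, curv br g (ee i) x y i

/-- Scalar curvature: the `g`-trace of the Ricci tensor. -/
def scal (br : V4 → V4 → V4) (g : V4 → V4 → ℝ) : ℝ :=
  ∑ a, ∑ b, ginv g a b * ricci br g (ee a) (ee b)

/-- Trace-free Ricci tensor `Ric₀ = Ric − (s/4) g`. -/
def ricci0 (br : V4 → V4 → V4) (g : V4 → V4 → ℝ) (x y : V4) : ℝ :=
  ricci br g x y - (scal br g / 4) * g x y

/-- `g` is Einstein: `Ric₀ = 0`. -/
def IsEinstein (br : V4 → V4 → V4) (g : V4 → V4 → ℝ) : Prop :=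
  ∀ x y, ricci0 br g x y = 0

/-- The endomorphism `F̂` with `g(F̂x, y) = F(x,y)` (computed via the inverse Gram matrix). -/
def fhat (g F : V4 → V4 → ℝ) (x : V4) : V4 :=
  fun m => ∑ k, F x (ee k) * ginv g k m

/-- `[F∘F]₀(x,y) = g(F̂(F̂x), y) − (1/4) tr(F̂∘F̂) g(x,y)`. -/
def FF0 (g F : V4 → V4 → ℝ) (x y : V4) : ℝ :=
  g (fhat g F (fhat g F x)) y
    - (1 / 4) * (∑ i, fhat g F (fhat g F (ee i)) i) * g x y

/-- `(g, F)` is a solution of the Einstein--Maxwell equations: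
`dF = 0`, `d(⋆F) = 0`, and `Ric₀ = −[F∘F]₀`. -/
def IsEMSolution (br : V4 → V4 → V4) (g F : V4 → V4 → ℝ) : Prop :=
  IsClosedForm br F ∧ IsCoclosed br g F ∧ ∀ x y, ricci0 br g x y = - FF0 g F x y

/-- Nijenhuis tensor `N_J(x,y) = [Jx,Jy] − J[Jx,y] − J[x,Jy] − [x,y]`. -/
def nijenhuis (br : V4 → V4 → V4) (J : V4 →ₗ[ℝ] V4) (x y : V4) : V4 :=
  br (J x) (J y) - J (br (J x) y) - J (br x (J y)) - br x y

/-- The Lie algebra `𝒜₄,₆^{a,b}`: `[e₁,e₄] = a e₁`, `[e₂,e₄] = b e₂ − e₃`, `[e₃,e₄] = e₂ + b e₃`. -/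
def brA46 (a b : ℝ) : V4 → V4 → V4 := fun x y =>
  (a * (x 0 * y 3 - x 3 * y 0)) • ee 0
    + (b * (x 1 * y 3 - x 3 * y 1) + (x 2 * y 3 - x 3 * y 2)) • ee 1
    + (-(x 1 * y 3 - x 3 * y 1) + b * (x 2 * y 3 - x 3 * y 2)) • ee 2

theorem ee_apply (i j : Fin 4) : ee i j = if j = i then 1 else 0 := by
  simp [ee, Pi.single_apply]

theorem sum_smul_ee (x : V4) : ∑ i, x i • ee i = x := by
  ext j
  simp [ee_apply]

/-- Expansion in the standard basis of the first argument of a left-linear function. -/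
theorem eq_sum_left {f : V4 → V4 → ℝ} (hadd : ∀ x y z, f (x + y) z = f x z + f y z)
    (hsmul : ∀ (a : ℝ) (x y : V4), f (a • x) y = a * f x y) (x y : V4) :
    f x y = ∑ i, x i * f (ee i) y := by
  let L : V4 →ₗ[ℝ] ℝ := ⟨⟨fun x => f x y, fun u v => hadd u v y⟩, fun c u => hsmul c u y⟩
  calc
    f x y = L (∑ i, x i • ee i) := by rw [sum_smul_ee]; rfl
    _ = ∑ i, x i * f (ee i) y := by rw [map_sum]; exact Finset.sum_congr rfl fun i _ => hsmul _ _ _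

theorem IsAltForm.self_eq_zero {F : V4 → V4 → ℝ} (hF : IsAltForm F) (x : V4) : F x x = 0 := by
  linarith [hF.skew x x]

theorem IsAltForm.eq_zero_of_basis {F : V4 → V4 → ℝ} (hF : IsAltForm F)
    (h : ∀ i j, F (ee i) (ee j) = 0) (x y : V4) : F x y = 0 := by
  have hl : ∀ j x, F x (ee j) = 0 := fun j x => by
    rw [eq_sum_left hF.add_left hF.smul_left]
    simp [h]
  rw [eq_sum_left hF.add_left hF.smul_left]
  refine Finset.sum_eq_zero fun i _ => ?_
  rw [hF.skew, hl, neg_zero, mul_zero]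

theorem IsInnerProduct.posDef_gram {g : V4 → V4 → ℝ} (hg : IsInnerProduct g) :
    (gram g).PosDef := by
  refine .of_dotProduct_mulVec_pos (Matrix.IsHermitian.ext fun i j => hg.symm _ _) fun x hx => ?_
  have hexp : g x x = star x ⬝ᵥ (gram g).mulVec x := by
    rw [eq_sum_left hg.add_left hg.smul_left]
    refine Finset.sum_congr rfl fun i _ => ?_
    rw [hg.symm, eq_sum_left hg.add_left hg.smul_left]
    change x i * _ = x i * ∑ j, g (ee i) (ee j) * x j
    refine congrArg (x i * ·) (Finset.sum_congr rfl fun j _ => ?_)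
    rw [mul_comm, hg.symm]
  exact hexp ▸ hg.pos x hx

theorem IsInnerProduct.vol_ee_pos {g : V4 → V4 → ℝ} (hg : IsInnerProduct g) :
    0 < vol g (ee 0) (ee 1) (ee 2) (ee 3) := by
  have h1 : (Matrix.of fun i j => ![ee 0, ee 1, ee 2, ee 3] i j) =
      (1 : Matrix (Fin 4) (Fin 4) ℝ) := by
    ext i j
    fin_cases i <;> fin_cases j <;> simp [ee_apply]
  rw [vol, h1, Matrix.det_one, mul_one]
  exact Real.sqrt_pos.2 hg.posDef_gram.det_pos

open scoped Kronecker in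
/-- The inner product induced on 2-forms is definite. -/
theorem IsInnerProduct.eq_zero_of_formInner_self {g F : V4 → V4 → ℝ} (hg : IsInnerProduct g)
    (h : formInner g F F = 0) (i j : Fin 4) : F (ee i) (ee j) = 0 := by
  have hpos : (ginv g ⊗ₖ ginv g).PosDef := hg.posDef_gram.inv.kronecker hg.posDef_gram.inv
  let v : Fin 4 × Fin 4 → ℝ := fun p => F (ee p.1) (ee p.2)
  have hv : star v ⬝ᵥ (ginv g ⊗ₖ ginv g).mulVec v = 2 * formInner g F F := by
    rw [formInner, ← mul_assoc]
    norm_num only [one_mul]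
    simp only [dotProduct, Matrix.mulVec, Fintype.sum_prod_type, Finset.mul_sum,
      Matrix.kroneckerMap_apply]
    refine Finset.sum_congr rfl fun i _ => Finset.sum_congr rfl fun j _ =>
      Finset.sum_congr rfl fun k _ => Finset.sum_congr rfl fun l _ => ?_
    simp only [v, Pi.star_apply, star_trivial]
    ring
  have hv0 : v = 0 := by
    by_contra hne
    have := hpos.dotProduct_mulVec_pos hne
    rw [hv, h] at this
    norm_num at this
  exact congrFun hv0 (i, j)

/-- A closed 2-form on `𝒜₄,₆^{a,b}` vanishes on the abelian ideal spanned by `e₁, e₂, e₃`. -/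
theorem eq_zero_on_ideal_of_closed {a b : ℝ} (hb : 0 < b) {F : V4 → V4 → ℝ} (hF : IsAltForm F)
    (hc : IsClosedForm (brA46 a b) F) :
    F (ee 0) (ee 1) = 0 ∧ F (ee 0) (ee 2) = 0 ∧ F (ee 1) (ee 2) = 0 := by
  have h01 := hc (ee 0) (ee 1) (ee 3)
  have h02 := hc (ee 0) (ee 2) (ee 3)
  have h12 := hc (ee 1) (ee 2) (ee 3)
  have hz : ∀ y, F 0 y = 0 := fun y => by simpa using hF.smul_left 0 0 y
  have hn : ∀ x y, F (-x) y = -F x y := fun x y => by simpa using hF.smul_left (-1) x y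
  simp [cdiff, brA46, ee_apply, hz, hn, hF.add_left, hF.smul_left, hF.self_eq_zero] at h01 h02 h12
  rw [hF.skew (ee 1) (ee 0), hF.skew (ee 2) (ee 0)] at h01 h02
  rw [hF.skew (ee 2) (ee 1)] at h12
  have e1 : F (ee 0) (ee 2) = (a + b) * F (ee 0) (ee 1) := by linarith
  have e2 : F (ee 0) (ee 1) = 0 := by
    rw [e1] at h02
    have : ((a + b) ^ 2 + 1) * F (ee 0) (ee 1) = 0 := by linarith
    exact (mul_eq_zero.1 this).resolve_left (by positivity)
  refine ⟨e2, by rw [e1, e2, mul_zero], ?_⟩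
  have : b * F (ee 1) (ee 2) = 0 := by linarith
  exact (mul_eq_zero.1 this).resolve_left hb.ne'

theorem eq_zero_of_closed_of_coclosed {a b : ℝ} (hb : 0 < b) {g F : V4 → V4 → ℝ}
    (hg : IsInnerProduct g) (hF : IsAltForm F) (hc : IsClosedForm (brA46 a b) F)
    (hcc : IsCoclosed (brA46 a b) g F) (x y : V4) : F x y = 0 := by
  obtain ⟨sF, ⟨hsF, hstar⟩, hsc⟩ := hcc
  obtain ⟨h01, h02, h12⟩ := eq_zero_on_ideal_of_closed hb hF hc
  obtain ⟨s01, s02, s12⟩ := eq_zero_on_ideal_of_closed hb hsF hsc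
  have h := hstar F hF (ee 0) (ee 1) (ee 2) (ee 3)
  simp only [wedge22, h01, h02, h12, s01, s02, s12, zero_mul, mul_zero, sub_zero, add_zero] at h
  exact hF.eq_zero_of_basis (hg.eq_zero_of_formInner_self
    ((mul_eq_zero.1 h.symm).resolve_right hg.vol_ee_pos.ne')) x y

theorem FF0_eq_zero {g F : V4 → V4 → ℝ} (hg : IsInnerProduct g) (hF : ∀ x y, F x y = 0)
    (x y : V4) : FF0 g F x y = 0 := by
  have hfhat : ∀ x, fhat g F x = 0 := fun x => by
    ext m
    simp [fhat, hF]
  have hz : g 0 y = 0 := by simpa using hg.smul_left 0 0 y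
  simp [FF0, hfhat, hz]

/-- `𝒜₄,₆^{a,b}` (`a ≠ 0`, `b > 0`) admits no left-invariant non-Einstein solution to the Einstein--Maxwell equations; in fact the only closed and co-closed 2-form is `F = 0`. -/
theorem stmt12 (a b : ℝ) (ha : a ≠ 0) (hb : 0 < b) :
    (∀ g F : V4 → V4 → ℝ, IsInnerProduct g → IsAltForm F →
      IsEMSolution (brA46 a b) g F → IsEinstein (brA46 a b) g) ∧
    (∀ g F : V4 → V4 → ℝ, IsInnerProduct g → IsAltForm F →
      IsClosedForm (brA46 a b) F → IsCoclosed (brA46 a b) g F → ∀ x y, F x y = 0) := by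
  refine ⟨fun g F hg hF hEM x y => ?_, fun g F hg hF hc hcc =>
    eq_zero_of_closed_of_coclosed hb hg hF hc hcc⟩
  obtain ⟨hc, hcc, hric⟩ := hEM
  rw [hric, FF0_eq_zero hg (eq_zero_of_closed_of_coclosed hb hg hF hc hcc), neg_zero]
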